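/- arXiv:1702.07810 — 10 statements merged into one kernel-verified Lean document; each statement's English description precedes it below -/
import Mathlib

section
/- Let μ ∈ ℝ^K be a probability vector sorted in non-increasing order (μ_1 ≥ μ_2 ≥ … ≥ μ_K ≥ 0, Σ_k μ_k = 1) and let H = diag(μ) − μμᵀ. Let s, v ∈ ℝ^K be non-increasing vectors such that for every k ∈ {1,…,K−1}, 0 ≤ s_k − s_{k+1} ≤ v_k − v_{k+1} ≤ 2(s_k − s_{k+1}). Then sᵀHs ≤ vᵀHv ≤ 4·sᵀHs. -/
open Matrix

theorem quad_eq {K : ℕ} (μ x : Fin K → ℝ) (h1 : ∑ i, μ i = 1) :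
    2 * (x ⬝ᵥ (Matrix.diagonal μ - Matrix.vecMulVec μ μ) *ᵥ x)
      = ∑ i, ∑ j, μ i * μ j * (x i - x j) ^ 2 := by
  have hR : ∑ i, ∑ j, μ i * μ j * (x i - x j) ^ 2
      = 2 * ((∑ i, μ i * x i ^ 2) * ∑ j, μ j) - 2 * ((∑ i, μ i * x i) * ∑ j, μ j * x j) := by
    have e : ∀ i j, μ i * μ j * (x i - x j) ^ 2 = (μ i * x i ^ 2) * μ j + μ i * (μ j * x j ^ 2)
        - 2 * ((μ i * x i) * (μ j * x j)) := by
      intro i j; ring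
    simp only [e, Finset.sum_sub_distrib, Finset.sum_add_distrib, ← Finset.mul_sum,
      ← Finset.sum_mul]
    ring
  have hL : x ⬝ᵥ (Matrix.diagonal μ - Matrix.vecMulVec μ μ) *ᵥ x
      = (∑ i, μ i * x i ^ 2) - (∑ i, μ i * x i) * ∑ j, μ j * x j := by
    rw [Matrix.sub_mulVec, dotProduct_sub]
    congr 1
    · simp only [dotProduct, Matrix.mulVec_diagonal]
      exact Finset.sum_congr rfl fun i _ => by ring
    · simp only [dotProduct, Matrix.mulVec, Matrix.vecMulVec_apply]
      rw [Finset.sum_mul]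
      refine Finset.sum_congr rfl fun i _ => ?_
      simp only [mul_assoc, ← Finset.mul_sum]
      ring
  rw [hR, hL, h1]; ring

theorem pair_bound {K : ℕ} (s v : Fin K → ℝ)
    (hdiff : ∀ i j : Fin K, (j : ℕ) = (i : ℕ) + 1 →
      0 ≤ s i - s j ∧ s i - s j ≤ v i - v j ∧ v i - v j ≤ 2 * (s i - s j)) (n : ℕ) :
    ∀ i j : Fin K, (j : ℕ) = (i : ℕ) + n →
      0 ≤ s i - s j ∧ s i - s j ≤ v i - v j ∧ v i - v j ≤ 2 * (s i - s j) := by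
  induction n with
  | zero =>
    intro i j h
    have : j = i := Fin.ext (by simpa using h)
    subst this
    simp
  | succ n ih =>
    intro i j h
    have hj := j.isLt
    obtain ⟨a, b, c⟩ := ih i ⟨i + n, by omega⟩ rfl
    obtain ⟨a', b', c'⟩ := hdiff ⟨i + n, by omega⟩ j (by simp; omega)
    refine ⟨?_, ?_, ?_⟩ <;> linarith

theorem sq_bound {K : ℕ} (s v : Fin K → ℝ)
    (hdiff : ∀ i j : Fin K, (j : ℕ) = (i : ℕ) + 1 →
      0 ≤ s i - s j ∧ s i - s j ≤ v i - v j ∧ v i - v j ≤ 2 * (s i - s j)) (i j : Fin K) :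
    (s i - s j) ^ 2 ≤ (v i - v j) ^ 2 ∧ (v i - v j) ^ 2 ≤ 4 * (s i - s j) ^ 2 := by
  rcases le_total (i : ℕ) (j : ℕ) with h | h
  · obtain ⟨a, b, c⟩ := pair_bound s v hdiff (j - i) i j (by omega)
    constructor <;> nlinarith
  · obtain ⟨a, b, c⟩ := pair_bound s v hdiff (i - j) j i (by omega)
    constructor <;> nlinarith

/-- For a sorted probability vector `μ` with covariance matrix
`H = diag(μ) − μμᵀ`, and non-increasing vectors `s, v` whose consecutive differences
satisfy `0 ≤ s_k − s_{k+1} ≤ v_k − v_{k+1} ≤ 2(s_k − s_{k+1})`, we have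
`sᵀHs ≤ vᵀHv ≤ 4 sᵀHs`. -/
theorem stmt_0 (K : ℕ) (μ s v : Fin K → ℝ)
    (hμ_mono : ∀ i j : Fin K, i ≤ j → μ j ≤ μ i)
    (hμ_nonneg : ∀ i, 0 ≤ μ i)
    (hμ_sum : ∑ i, μ i = 1)
    (hs_mono : ∀ i j : Fin K, i ≤ j → s j ≤ s i)
    (hv_mono : ∀ i j : Fin K, i ≤ j → v j ≤ v i)
    (hdiff : ∀ i j : Fin K, (j : ℕ) = (i : ℕ) + 1 →
      0 ≤ s i - s j ∧ s i - s j ≤ v i - v j ∧ v i - v j ≤ 2 * (s i - s j))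
    (H : Matrix (Fin K) (Fin K) ℝ)
    (hH : H = Matrix.diagonal μ - Matrix.vecMulVec μ μ) :
    s ⬝ᵥ H *ᵥ s ≤ v ⬝ᵥ H *ᵥ v ∧ v ⬝ᵥ H *ᵥ v ≤ 4 * (s ⬝ᵥ H *ᵥ s) := by
  subst hH
  have h1 := quad_eq μ s hμ_sum
  have h2 := quad_eq μ v hμ_sum
  have hA : ∑ i, ∑ j, μ i * μ j * (s i - s j) ^ 2 ≤ ∑ i, ∑ j, μ i * μ j * (v i - v j) ^ 2 :=
    Finset.sum_le_sum fun i _ => Finset.sum_le_sum fun j _ =>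
      mul_le_mul_of_nonneg_left (sq_bound s v hdiff i j).1
        (mul_nonneg (hμ_nonneg i) (hμ_nonneg j))
  have hB : ∑ i, ∑ j, μ i * μ j * (v i - v j) ^ 2
      ≤ 4 * ∑ i, ∑ j, μ i * μ j * (s i - s j) ^ 2 := by
    simp only [Finset.mul_sum]
    refine Finset.sum_le_sum fun i _ => Finset.sum_le_sum fun j _ => ?_
    have := mul_le_mul_of_nonneg_left (sq_bound s v hdiff i j).2
        (mul_nonneg (hμ_nonneg i) (hμ_nonneg j))
    linarith
  constructor <;> linarith
end

section
/- Let μ ∈ ℝ^K be a probability vector sorted in non-increasing order (μ_1 ≥ μ_2 ≥ … ≥ μ_K ≥ 0, Σ_k μ_k = 1) and let H = diag(μ) − μμᵀ. Let s, v ∈ ℝ^K be non-increasing vectors such that for every k ∈ {1,…,K−1}, 0 ≤ s_k − s_{k+1} ≤ v_k − v_{k+1} ≤ 2(s_k − s_{k+1}). Then sᵀH²s ≤ vᵀH²v ≤ 4·sᵀH²s, where H² denotes the matrix square of H. -/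
open Matrix

lemma cheb_aux {K : ℕ} (w f g : Fin K → ℝ) (hw : ∀ i, 0 ≤ w i)
    (hf : ∀ i j : Fin K, i ≤ j → f j ≤ f i) (hg : ∀ i j : Fin K, i ≤ j → g j ≤ g i) :
    (∑ i, w i * f i) * (∑ i, w i * g i) ≤ (∑ i, w i) * ∑ i, w i * f i * g i := by
  have h : 0 ≤ ∑ i, ∑ j, w i * w j * ((f i - f j) * (g i - g j)) := by
    refine Finset.sum_nonneg fun i _ => Finset.sum_nonneg fun j _ => ?_
    refine mul_nonneg (mul_nonneg (hw i) (hw j)) ?_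
    rcases le_total i j with h | h
    · exact mul_nonneg (sub_nonneg.2 (hf i j h)) (sub_nonneg.2 (hg i j h))
    · exact mul_nonneg_of_nonpos_of_nonpos (sub_nonpos.2 (hf j i h)) (sub_nonpos.2 (hg j i h))
  have e : ∑ i, ∑ j, w i * w j * ((f i - f j) * (g i - g j))
      = (∑ i, w i * f i * g i) * (∑ i, w i) - (∑ i, w i * f i) * (∑ i, w i * g i)
        - (∑ i, w i * g i) * (∑ i, w i * f i) + (∑ i, w i) * ∑ i, w i * f i * g i := by
    simp only [Finset.sum_mul_sum, ← Finset.sum_sub_distrib, ← Finset.sum_add_distrib]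
    refine Finset.sum_congr rfl fun i _ => Finset.sum_congr rfl fun j _ => ?_
    ring
  rw [e] at h
  linarith

lemma key_aux {K : ℕ} (μ a b : Fin K → ℝ)
    (hm : ∀ i j : Fin K, i ≤ j → μ j ≤ μ i) (h0 : ∀ i, 0 ≤ μ i) (h1 : ∑ i, μ i = 1)
    (ha : ∀ i j : Fin K, i ≤ j → a j ≤ a i) (hb : ∀ i j : Fin K, i ≤ j → b j ≤ b i) :
    0 ≤ ∑ i, (μ i * (a i - ∑ k, μ k * a k)) * (μ i * (b i - ∑ k, μ k * b k)) := by
  have pos : ∀ c : Fin K → ℝ, (∀ i j : Fin K, i ≤ j → c j ≤ c i) →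
      0 ≤ ∑ i, (μ i * μ i) * (c i - ∑ k, μ k * c k) := by
    intro c hc
    have h := cheb_aux μ μ (fun i => c i - ∑ k, μ k * c k) h0 hm
      (fun i j h => sub_le_sub_right (hc i j h) _)
    have e : ∑ i, μ i * (c i - ∑ k, μ k * c k) = 0 := by
      simp only [mul_sub, Finset.sum_sub_distrib, ← Finset.sum_mul, h1]
      ring
    simpa [e, h1] using h
  have h := cheb_aux (fun i => μ i * μ i) (fun i => a i - ∑ k, μ k * a k)
    (fun i => b i - ∑ k, μ k * b k) (fun i => mul_nonneg (h0 i) (h0 i))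
    (fun i j h => sub_le_sub_right (ha i j h) _) (fun i j h => sub_le_sub_right (hb i j h) _)
  have h2 := (mul_nonneg (pos a ha) (pos b hb)).trans h
  have hM : 0 < ∑ i, μ i * μ i := by
    refine lt_of_le_of_ne (Finset.sum_nonneg fun i _ => mul_nonneg (h0 i) (h0 i)) fun h => ?_
    rw [eq_comm, Finset.sum_eq_zero_iff_of_nonneg (fun i _ => mul_nonneg (h0 i) (h0 i))] at h
    have : ∑ i, μ i = 0 := Finset.sum_eq_zero fun i hi => mul_self_eq_zero.1 (h i hi)
    linarith
  have h3 := nonneg_of_mul_nonneg_right h2 hM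
  refine h3.trans_eq (Finset.sum_congr rfl fun i _ => ?_)
  ring

lemma anti_aux {K : ℕ} (d : Fin K → ℝ)
    (h : ∀ i j : Fin K, (j : ℕ) = (i : ℕ) + 1 → d j ≤ d i) :
    ∀ i j : Fin K, i ≤ j → d j ≤ d i := by
  have key : ∀ n : ℕ, ∀ i j : Fin K, (j : ℕ) = (i : ℕ) + n → d j ≤ d i := by
    intro n
    induction n with
    | zero => intro i j e; rw [Fin.ext (by simpa using e : (j : ℕ) = i)]
    | succ n ih =>
      intro i j e
      have hj := j.2
      have h1 := ih i ⟨i + n, by omega⟩ rfl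
      exact (h ⟨i + n, by omega⟩ j (by simp only; omega)).trans h1
  intro i j hij
  have : (i : ℕ) ≤ j := hij
  exact key (j - i) i j (by omega)

lemma quad_aux {K : ℕ} (μ a b : Fin K → ℝ) (H : Matrix (Fin K) (Fin K) ℝ)
    (hH : H = Matrix.diagonal μ - Matrix.vecMulVec μ μ) :
    a ⬝ᵥ (H * H) *ᵥ b
      = ∑ i, (μ i * (a i - ∑ k, μ k * a k)) * (μ i * (b i - ∑ k, μ k * b k)) := by
  have hT : Hᵀ = H := by
    subst hH
    ext i j
    by_cases h : i = j
    · subst h; simp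
    · simp [Matrix.diagonal_apply, Matrix.vecMulVec_apply, h, Ne.symm h, mul_comm]
  have hv : ∀ c : Fin K → ℝ, ∀ i, (H *ᵥ c) i = μ i * (c i - ∑ k, μ k * c k) := by
    intro c i
    subst hH
    simp [Matrix.sub_mulVec, Matrix.mulVec_diagonal, Matrix.vecMulVec_mulVec, dotProduct]
    ring
  rw [← Matrix.mulVec_mulVec, Matrix.dotProduct_mulVec, ← Matrix.mulVec_transpose, hT]
  simp only [dotProduct, hv]

/-- For a sorted probability vector `μ` with covariance matrix
`H = diag(μ) − μμᵀ`, and non-increasing vectors `s, v` whose consecutive differences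
satisfy `0 ≤ s_k − s_{k+1} ≤ v_k − v_{k+1} ≤ 2(s_k − s_{k+1})`, we have
`sᵀH²s ≤ vᵀH²v ≤ 4 sᵀH²s`. -/
theorem stmt_1 (K : ℕ) (μ s v : Fin K → ℝ)
    (hμ_mono : ∀ i j : Fin K, i ≤ j → μ j ≤ μ i)
    (hμ_nonneg : ∀ i, 0 ≤ μ i)
    (hμ_sum : ∑ i, μ i = 1)
    (hs_mono : ∀ i j : Fin K, i ≤ j → s j ≤ s i)
    (hv_mono : ∀ i j : Fin K, i ≤ j → v j ≤ v i)
    (hdiff : ∀ i j : Fin K, (j : ℕ) = (i : ℕ) + 1 →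
      0 ≤ s i - s j ∧ s i - s j ≤ v i - v j ∧ v i - v j ≤ 2 * (s i - s j))
    (H : Matrix (Fin K) (Fin K) ℝ)
    (hH : H = Matrix.diagonal μ - Matrix.vecMulVec μ μ) :
    s ⬝ᵥ (H * H) *ᵥ s ≤ v ⬝ᵥ (H * H) *ᵥ v ∧
      v ⬝ᵥ (H * H) *ᵥ v ≤ 4 * (s ⬝ᵥ (H * H) *ᵥ s) := by
  have q : ∀ a b : Fin K → ℝ, (∀ i j : Fin K, i ≤ j → a j ≤ a i) →
      (∀ i j : Fin K, i ≤ j → b j ≤ b i) → 0 ≤ a ⬝ᵥ (H * H) *ᵥ b := by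
    intro a b ha hb
    rw [quad_aux μ a b H hH]
    exact key_aux μ a b hμ_mono hμ_nonneg hμ_sum ha hb
  have sym : v ⬝ᵥ (H * H) *ᵥ s = s ⬝ᵥ (H * H) *ᵥ v := by
    rw [quad_aux μ _ _ H hH, quad_aux μ _ _ H hH]
    exact Finset.sum_congr rfl fun i _ => mul_comm _ _
  have d1 := anti_aux (v - s) (by
    intro i j h
    have := hdiff i j h
    simp only [Pi.sub_apply]
    linarith)
  have d2 := anti_aux ((2 : ℝ) • s - v) (by
    intro i j h
    have := hdiff i j h
    simp only [Pi.sub_apply, Pi.smul_apply, smul_eq_mul]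
    linarith)
  have a1 := q _ s d1 hs_mono
  have a2 := q _ v d1 hv_mono
  have b1 := q _ s d2 hs_mono
  have b2 := q _ v d2 hv_mono
  simp only [sub_dotProduct, smul_dotProduct, smul_eq_mul] at a1 a2 b1 b2
  constructor <;> linarith
end

section
/- Let μ ∈ ℝ^K be a probability vector sorted in non-increasing order (μ_1 ≥ μ_2 ≥ … ≥ μ_K ≥ 0, Σ_k μ_k = 1) and let H = diag(μ) − μμᵀ. For 1 ≤ k ≤ K let z_k ∈ ℝ^K be the vector whose first k coordinates equal 1 and whose remaining coordinates equal 0. Then for all 1 ≤ k ≤ ℓ ≤ K, z_kᵀ H² z_ℓ ≥ 0. -/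
open Matrix

/-- For a sorted probability vector `μ` with covariance matrix
`H = diag(μ) − μμᵀ`, and `z_k` the vector whose first `k` coordinates are `1` and
remaining coordinates `0`, we have `z_kᵀ H² z_ℓ ≥ 0` for all `1 ≤ k ≤ ℓ ≤ K`. -/
theorem stmt_2 (K : ℕ) (μ : Fin K → ℝ)
    (hμ_mono : ∀ i j : Fin K, i ≤ j → μ j ≤ μ i)
    (hμ_nonneg : ∀ i, 0 ≤ μ i)
    (hμ_sum : ∑ i, μ i = 1)
    (H : Matrix (Fin K) (Fin K) ℝ)
    (hH : H = Matrix.diagonal μ - Matrix.vecMulVec μ μ)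
    (z : ℕ → Fin K → ℝ)
    (hz : ∀ (k : ℕ) (i : Fin K), z k i = if (i : ℕ) < k then 1 else 0)
    (k ℓ : ℕ) (hk : 1 ≤ k) (hkl : k ≤ ℓ) (hlK : ℓ ≤ K) :
    0 ≤ z k ⬝ᵥ (H * H) *ᵥ z ℓ := by
  have hs : ∀ j, ∀ i, (H *ᵥ z j) i = μ i * (z j i - ∑ a, μ a * z j a) := by
    intro j i
    rw [hH, Matrix.sub_mulVec, Pi.sub_apply, Matrix.mulVec_diagonal]
    simp only [Matrix.mulVec, dotProduct, Matrix.vecMulVec_apply]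
    rw [mul_sub, Finset.mul_sum]
    congr 1
    exact Finset.sum_congr rfl fun a _ => by ring
  have hT : Hᵀ = H := by
    rw [hH]
    ext i j
    by_cases h : i = j
    · subst h; simp
    · have h' : j ≠ i := fun e => h e.symm
      simp [Matrix.vecMulVec_apply, Matrix.diagonal_apply, h, h', mul_comm]
  have hval : z k ⬝ᵥ (H * H) *ᵥ z ℓ
      = ∑ i, (μ i * (z k i - ∑ a, μ a * z k a)) * (μ i * (z ℓ i - ∑ a, μ a * z ℓ a)) := by
    rw [← Matrix.mulVec_mulVec, Matrix.dotProduct_mulVec, ← Matrix.mulVec_transpose, hT]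
    simp only [dotProduct, hs]
  rw [hval]
  set s := ∑ a, μ a * z k a with hsdef
  set t := ∑ a, μ a * z ℓ a with htdef
  have z01 : ∀ j i, 0 ≤ z j i ∧ z j i ≤ 1 := by
    intro j i
    rw [hz]; split_ifs <;> norm_num
  have hs0 : 0 ≤ s := Finset.sum_nonneg fun i _ => mul_nonneg (hμ_nonneg i) (z01 k i).1
  have ht0 : 0 ≤ t := Finset.sum_nonneg fun i _ => mul_nonneg (hμ_nonneg i) (z01 ℓ i).1
  have hle1 : ∀ j, ∑ a, μ a * z j a ≤ 1 := by
    intro j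
    rw [← hμ_sum]
    exact Finset.sum_le_sum fun i _ => mul_le_of_le_one_right (hμ_nonneg i) (z01 j i).2
  have hs1 : s ≤ 1 := hle1 k
  have ht1 : t ≤ 1 := hle1 ℓ
  have hkK : k - 1 < K := by omega
  set m := μ ⟨k - 1, hkK⟩ with hm
  have hm0 : 0 ≤ m := hμ_nonneg _
  have hsum : ∑ i, (m * (1 - t)) * (μ i * z k i - s * (μ i * z ℓ i)) = m * s * (1 - t) ^ 2 := by
    rw [← Finset.mul_sum, Finset.sum_sub_distrib, ← Finset.mul_sum, ← hsdef, ← htdef]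
    ring
  have hfin : 0 ≤ m * s * (1 - t) ^ 2 := by positivity
  rw [← hsum] at hfin
  refine hfin.trans (Finset.sum_le_sum fun i _ => ?_)
  have h0 := hμ_nonneg i
  have ht1' : 0 ≤ 1 - t := by linarith
  have hs1' : 0 ≤ 1 - s := by linarith
  by_cases h1 : (i : ℕ) < k
  · have h2 : (i : ℕ) < ℓ := by omega
    have hmi : m ≤ μ i := hμ_mono _ _ (by rw [Fin.le_def]; simp only; omega)
    rw [hz, hz, if_pos h1, if_pos h2]
    have : 0 ≤ (μ i - m) * (μ i * ((1 - s) * (1 - t))) :=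
      mul_nonneg (by linarith) (by positivity)
    nlinarith [this]
  · have hmi : μ i ≤ m := hμ_mono _ _ (by rw [Fin.le_def]; simp only; omega)
    by_cases h2 : (i : ℕ) < ℓ
    · rw [hz, hz, if_neg h1, if_pos h2]
      have : 0 ≤ (m - μ i) * (μ i * (s * (1 - t))) :=
        mul_nonneg (by linarith) (by positivity)
      nlinarith [this]
    · rw [hz, hz, if_neg h1, if_neg h2]
      have : 0 ≤ μ i * μ i * (s * t) := by positivity
      nlinarith [this]
end

section
/- Let μ ∈ ℝ^K be a probability vector with all entries strictly positive, H = diag(μ) − μμᵀ, and D = diag(μ_1(1−μ_1), …, μ_K(1−μ_K)). Then for every v ∈ ℝ^K satisfying Σ_{j=1}^{K} v_j μ_j (1−μ_j) = 0, one has vᵀDv ≤ vᵀHv. -/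
open Matrix

/-- For a strictly positive probability vector `μ`, with
`H = diag(μ) − μμᵀ` and `D = diag(μ_k(1−μ_k))`, every `v` satisfying
`Σ_j v_j μ_j (1−μ_j) = 0` has `vᵀDv ≤ vᵀHv`. -/
theorem stmt_4 (K : ℕ) (μ : Fin K → ℝ)
    (hpos : ∀ i, 0 < μ i)
    (hsum : ∑ i, μ i = 1)
    (H D : Matrix (Fin K) (Fin K) ℝ)
    (hH : H = Matrix.diagonal μ - Matrix.vecMulVec μ μ)
    (hD : D = Matrix.diagonal (fun k => μ k * (1 - μ k)))
    (v : Fin K → ℝ)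
    (hv : ∑ j, v j * (μ j * (1 - μ j)) = 0) :
    v ⬝ᵥ D *ᵥ v ≤ v ⬝ᵥ H *ᵥ v := by
  have h1 : v ⬝ᵥ D *ᵥ v = ∑ i, μ i * v i ^ 2 - ∑ i, (μ i * v i) ^ 2 := by
    rw [hD, ← Finset.sum_sub_distrib]
    simp only [dotProduct, mulVec_diagonal]
    exact Finset.sum_congr rfl fun i _ => by ring
  have h2 : v ⬝ᵥ H *ᵥ v = ∑ i, μ i * v i ^ 2 - (∑ i, μ i * v i) ^ 2 := by
    rw [hH, sub_mulVec, dotProduct_sub]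
    congr 1
    · simp only [dotProduct, mulVec_diagonal]
      exact Finset.sum_congr rfl fun i _ => by ring
    · have : vecMulVec μ μ *ᵥ v = fun i => μ i * ∑ j, μ j * v j := by
        funext i
        simp only [mulVec, dotProduct, vecMulVec_apply, Finset.mul_sum, mul_assoc]
      rw [this, sq, Finset.sum_mul]
      simp only [dotProduct]
      exact Finset.sum_congr rfl fun i _ => by ring
  have h3 : ∑ i, μ i * v i = ∑ i, μ i * (μ i * v i) := by
    rw [← sub_eq_zero, ← Finset.sum_sub_distrib, ← hv]
    exact Finset.sum_congr rfl fun i _ => by ring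
  have h4 := Finset.sum_mul_sq_le_sq_mul_sq Finset.univ μ (fun i => μ i * v i)
  have h5 : ∑ i, μ i ^ 2 ≤ 1 := by
    rw [← hsum]
    refine Finset.sum_le_sum fun i _ => ?_
    have : μ i ≤ 1 := by
      rw [← hsum]
      exact Finset.single_le_sum (fun j _ => (hpos j).le) (Finset.mem_univ i)
    nlinarith [hpos i]
  have h6 : 0 ≤ ∑ i, (μ i * v i) ^ 2 := Finset.sum_nonneg fun i _ => sq_nonneg _
  rw [← h3] at h4
  rw [h1, h2]
  nlinarith [mul_le_mul_of_nonneg_right h5 h6]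
end

section
/- Let μ ∈ ℝ^K be a probability vector, H = diag(μ) − μμᵀ, and D = diag(μ_1(1−μ_1), …, μ_K(1−μ_K)). Then for every v ∈ ℝ^K, vᵀHv ≤ 2·vᵀDv. Equivalently, 2vᵀDv − vᵀHv = Σ_{j≠k} (1/2) μ_j μ_k (v_j + v_k)² ≥ 0. -/
open Matrix

/-- For a probability vector `μ`, with `H = diag(μ) − μμᵀ` and
`D = diag(μ_k(1−μ_k))`, every `v` satisfies `vᵀHv ≤ 2 vᵀDv`; equivalently
`2vᵀDv − vᵀHv = Σ_{j≠k} (1/2) μ_j μ_k (v_j+v_k)² ≥ 0`. -/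
theorem stmt_5 (K : ℕ) (μ : Fin K → ℝ)
    (hnonneg : ∀ i, 0 ≤ μ i)
    (hsum : ∑ i, μ i = 1)
    (H D : Matrix (Fin K) (Fin K) ℝ)
    (hH : H = Matrix.diagonal μ - Matrix.vecMulVec μ μ)
    (hD : D = Matrix.diagonal (fun k => μ k * (1 - μ k)))
    (v : Fin K → ℝ) :
    v ⬝ᵥ H *ᵥ v ≤ 2 * (v ⬝ᵥ D *ᵥ v) ∧
      2 * (v ⬝ᵥ D *ᵥ v) - v ⬝ᵥ H *ᵥ v =
        ∑ j, ∑ k ∈ Finset.univ.filter (fun k => k ≠ j),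
          (1 / 2) * (μ j * μ k) * (v j + v k) ^ 2 := by
  have key : 2 * (v ⬝ᵥ D *ᵥ v) - v ⬝ᵥ H *ᵥ v =
        ∑ j, ∑ k ∈ Finset.univ.filter (fun k => k ≠ j),
          (1 / 2) * (μ j * μ k) * (v j + v k) ^ 2 := by
    obtain ⟨A, hA⟩ : ∃ A, A = ∑ i, μ i * v i ^ 2 := ⟨_, rfl⟩
    obtain ⟨B, hB⟩ : ∃ B, B = ∑ i, μ i * v i := ⟨_, rfl⟩
    obtain ⟨C, hC⟩ : ∃ C, C = ∑ i, μ i ^ 2 * v i ^ 2 := ⟨_, rfl⟩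
    have h1 : v ⬝ᵥ D *ᵥ v = A - C := by
      rw [hD, hA, hC, ← Finset.sum_sub_distrib]
      simp only [dotProduct, Matrix.mulVec_diagonal]
      exact Finset.sum_congr rfl fun i _ => by ring
    have h2 : v ⬝ᵥ H *ᵥ v = A - B * B := by
      have h3 : ∀ i, (Matrix.vecMulVec μ μ *ᵥ v) i = μ i * B := by
        intro i
        simp only [Matrix.mulVec, dotProduct, Matrix.vecMulVec_apply]
        rw [hB, Finset.mul_sum]
        exact Finset.sum_congr rfl fun i _ => by ring
      rw [hH, Matrix.sub_mulVec]
      simp only [dotProduct, Pi.sub_apply, h3, Matrix.mulVec_diagonal]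
      conv_rhs => rw [hA]; arg 2; arg 1; rw [hB]
      rw [Finset.sum_mul, ← Finset.sum_sub_distrib]
      exact Finset.sum_congr rfl fun i _ => by ring
    have h4 : ∀ j, ∑ k ∈ Finset.univ.filter (fun k => k ≠ j),
          (1 / 2) * (μ j * μ k) * (v j + v k) ^ 2
        = (1 / 2) * (μ j * v j ^ 2) + (μ j * v j) * B + μ j * (A / 2)
          - 2 * (μ j ^ 2 * v j ^ 2) := by
      intro j
      have h5 : ∑ k, (1 / 2) * (μ j * μ k) * (v j + v k) ^ 2
          = (1 / 2) * (μ j * v j ^ 2) * (∑ k, μ k) + (μ j * v j) * B + (μ j / 2) * A := by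
        rw [hA, hB, Finset.mul_sum, Finset.mul_sum, Finset.mul_sum,
          ← Finset.sum_add_distrib, ← Finset.sum_add_distrib]
        exact Finset.sum_congr rfl fun i _ => by ring
      rw [Finset.filter_ne', Finset.sum_erase_eq_sub (Finset.mem_univ j), h5, hsum]
      ring
    simp only [h4]
    rw [Finset.sum_sub_distrib, Finset.sum_add_distrib, Finset.sum_add_distrib,
      ← Finset.mul_sum, ← Finset.mul_sum, ← Finset.sum_mul, ← Finset.sum_mul,
      hsum, ← hA, ← hB, ← hC, h1, h2]
    ring
  refine ⟨?_, key⟩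
  rw [← sub_nonneg, key]
  exact Finset.sum_nonneg fun j _ => Finset.sum_nonneg fun k _ => by
    have := hnonneg j
    have := hnonneg k
    positivity
end

section
/- Let A and B be real symmetric positive-semidefinite n×n matrices with the same column space, and let X and Y be the Moore–Penrose pseudoinverses of A and B respectively. Then B − A is positive semidefinite if and only if X − Y is positive semidefinite (i.e., A ⪯ B if and only if B⁺ ⪯ A⁺). -/
open Matrix

lemma mp_symm {n : ℕ} {A X : Matrix (Fin n) (Fin n) ℝ} (hA : Aᵀ = A)
    (h1 : A * X * A = A) (h2 : X * A * X = X)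
    (h3 : (A * X)ᵀ = A * X) (h4 : (X * A)ᵀ = X * A) :
    Xᵀ = X ∧ A * X = X * A := by
  rw [transpose_mul, hA] at h3 h4
  have e1 : A * X * X = X := by
    calc A * X * X = A * X * (X * A * X) := by rw [h2]
      _ = A * X * (A * Xᵀ * X) := by rw [h4]
      _ = (A * X * A) * Xᵀ * X := by simp only [Matrix.mul_assoc]
      _ = X := by rw [h1, h4, h2]
  have e2 : X * (X * A) = X := by
    calc X * (X * A) = (X * A * X) * (X * A) := by rw [h2]
      _ = X * (A * X) * (X * A) := by simp only [Matrix.mul_assoc]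
      _ = X * (Xᵀ * A) * (X * A) := by rw [h3]
      _ = X * Xᵀ * (A * X * A) := by simp only [Matrix.mul_assoc]
      _ = X * (Xᵀ * A) := by rw [h1, Matrix.mul_assoc]
      _ = X := by rw [h3, ← Matrix.mul_assoc, h2]
  have e3 : A * X = X * A := by
    calc A * X = A * (X * (X * A)) := by rw [e2]
      _ = (A * X * X) * A := by simp only [Matrix.mul_assoc]
      _ = X * A := by rw [e1]
  refine ⟨?_, e3⟩
  calc Xᵀ = (X * A * X)ᵀ := by rw [h2]
    _ = (Xᵀ * A) * Xᵀ := by simp only [transpose_mul, hA, Matrix.mul_assoc]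
    _ = X * (A * Xᵀ) := by rw [h3, e3, Matrix.mul_assoc]
    _ = X := by rw [h4, e2]

lemma mp_dir {n : ℕ} {A B X Y : Matrix (Fin n) (Fin n) ℝ} (hA : A.PosSemidef)
    (hX : Xᵀ = X) (hY : Yᵀ = Y) (h1 : X * A * X = X) (h2 : Y * B * Y = Y)
    (h3 : X * A * Y = Y) (h4 : Y * A * X = Y) (h : (B - A).PosSemidef) :
    (X - Y).PosSemidef := by
  have p := (hA.conjTranspose_mul_mul_same (X - Y)).add (h.conjTranspose_mul_mul_same Y)
  rw [conjTranspose_eq_transpose_of_trivial, conjTranspose_eq_transpose_of_trivial,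
    transpose_sub, hX, hY] at p
  convert p using 1
  simp only [Matrix.sub_mul, Matrix.mul_sub, h1, h2, h3, h4]
  abel

lemma mp_range {n : ℕ} {A B X : Matrix (Fin n) (Fin n) ℝ} (h1 : A * X * A = A)
    (h : LinearMap.range (Matrix.toLin' B) ≤ LinearMap.range (Matrix.toLin' A)) :
    A * X * B = B := by
  apply Matrix.toLin'.injective
  ext1 i
  ext1
  obtain ⟨w, hw⟩ := h ⟨Pi.single i 1, rfl⟩
  simp only [toLin'_apply, LinearMap.comp_apply, LinearMap.coe_single] at hw ⊢
  rw [← mulVec_mulVec, ← hw, mulVec_mulVec, h1]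

/-- For real symmetric PSD matrices `A, B` with the same column space,
with Moore–Penrose pseudoinverses `X, Y` respectively, `A ⪯ B` iff `B⁺ ⪯ A⁺`,
i.e. `B − A` is PSD iff `X − Y` is PSD. -/
theorem stmt_8 (n : ℕ) (A B X Y : Matrix (Fin n) (Fin n) ℝ)
    (hA : A.PosSemidef) (hB : B.PosSemidef)
    (hrange : LinearMap.range (Matrix.toLin' A) = LinearMap.range (Matrix.toLin' B))
    (hX1 : A * X * A = A) (hX2 : X * A * X = X)
    (hX3 : (A * X)ᵀ = A * X) (hX4 : (X * A)ᵀ = X * A)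
    (hY1 : B * Y * B = B) (hY2 : Y * B * Y = Y)
    (hY3 : (B * Y)ᵀ = B * Y) (hY4 : (Y * B)ᵀ = Y * B) :
    (B - A).PosSemidef ↔ (X - Y).PosSemidef := by
  have sA : Aᵀ = A := by simpa using hA.1.eq
  have sB : Bᵀ = B := by simpa using hB.1.eq
  obtain ⟨sX, cX⟩ := mp_symm sA hX1 hX2 hX3 hX4
  obtain ⟨sY, cY⟩ := mp_symm sB hY1 hY2 hY3 hY4
  have r1 : A * X * B = B := mp_range hX1 hrange.ge
  have r2 : B * Y * A = A := mp_range hY1 hrange.le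
  have r2' : A * Y * B = A := by
    have := congrArg transpose r2
    simpa only [transpose_mul, sA, sB, sY, ← Matrix.mul_assoc] using this
  have eY : B * Y * Y = Y := by rw [cY, hY2]
  have r3 : X * A * Y = Y := by
    rw [← cX]
    calc A * X * Y = A * X * (B * Y * Y) := by rw [eY]
      _ = (A * X * B) * Y * Y := by simp only [Matrix.mul_assoc]
      _ = Y := by rw [r1, eY]
  have r3' : Y * A * X = Y := by
    have := congrArg transpose r3
    simpa only [transpose_mul, sA, sX, sY, ← Matrix.mul_assoc] using this
  have pY : Y.PosSemidef := by
    have := hB.conjTranspose_mul_mul_same Y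
    rwa [conjTranspose_eq_transpose_of_trivial, sY, hY2] at this
  exact ⟨mp_dir hA sX sY hX2 hY2 r3 r3', mp_dir pY sB sA hY1 hX1 r2 r2'⟩
end

section
/- Let M be a real symmetric positive-semidefinite n×n matrix, let π : {1,…,n} → {1,…,m} be any map assigning each coordinate to one of m blocks, and let 𝒟(M) be the block-diagonal part of M, i.e., 𝒟(M)_{ij} = M_{ij} if π(i) = π(j) and 𝒟(M)_{ij} = 0 otherwise. Then (i) for every u ∈ ℝ^n, uᵀMu ≤ m · uᵀ𝒟(M)u, and (ii) the column space of M is contained in the column space of 𝒟(M). -/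
open Matrix

lemma block_ineq (n m : ℕ) (M : Matrix (Fin n) (Fin n) ℝ) (hM : M.PosSemidef)
    (π : Fin n → Fin m)
    (D : Matrix (Fin n) (Fin n) ℝ)
    (hD : ∀ i j, D i j = if π i = π j then M i j else 0) (u : Fin n → ℝ) :
    u ⬝ᵥ M *ᵥ u ≤ (m : ℝ) * (u ⬝ᵥ D *ᵥ u) := by
  have hnn : ∀ w : Fin n → ℝ, 0 ≤ w ⬝ᵥ M *ᵥ w := fun w => by
    simpa using hM.dotProduct_mulVec_nonneg w
  have hsym : ∀ v w : Fin n → ℝ, v ⬝ᵥ M *ᵥ w = w ⬝ᵥ M *ᵥ v := fun v w => by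
    have h : Mᵀ = M := by simpa using hM.isHermitian.eq
    rw [dotProduct_mulVec, ← mulVec_transpose, h, dotProduct_comm]
  let r : Fin m → Fin n → ℝ := fun a i => if π i = a then u i else 0
  have hu : u = ∑ a, r a := by
    ext i; simp [r, Finset.sum_apply]
  have h1 : u ⬝ᵥ M *ᵥ u = ∑ a, ∑ b, r a ⬝ᵥ M *ᵥ r b := by
    conv_lhs => rw [hu]
    simp only [mulVec_sum, sum_dotProduct, dotProduct_sum]
    exact Finset.sum_comm
  have h2 : u ⬝ᵥ D *ᵥ u = ∑ a, r a ⬝ᵥ M *ᵥ r a := by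
    simp only [dotProduct, mulVec, Finset.mul_sum, hD, r]
    rw [Finset.sum_comm]
    conv_rhs => rw [Finset.sum_comm]
    rw [Finset.sum_comm]
    refine Finset.sum_congr rfl fun i _ => ?_
    rw [Finset.sum_comm]
    refine Finset.sum_congr rfl fun j _ => ?_
    rw [Finset.sum_eq_single (π i)]
    · by_cases h : π i = π j
      · simp [h]
      · simp [h, Ne.symm h]
    · intro b _ hb
      simp [Ne.symm hb]
    · simp
  have h3 : ∀ a b, r a ⬝ᵥ M *ᵥ r b ≤ (r a ⬝ᵥ M *ᵥ r a + r b ⬝ᵥ M *ᵥ r b) / 2 := fun a b => by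
    have := hnn (r a - r b)
    rw [mulVec_sub, sub_dotProduct, dotProduct_sub, dotProduct_sub, hsym (r b) (r a)] at this
    linarith
  rw [h1, h2]
  refine (Finset.sum_le_sum fun a _ => Finset.sum_le_sum fun b _ => h3 a b).trans (le_of_eq ?_)
  simp only [← Finset.sum_div, Finset.sum_add_distrib, Finset.sum_const, Finset.card_univ,
    Fintype.card_fin, nsmul_eq_mul, ← Finset.mul_sum]
  ring

/-- For a real symmetric PSD matrix `M` and a partition of the
coordinates into `m` blocks (fibers of `π`), let `𝒟(M)` be the block-diagonal part
of `M`. Then `uᵀMu ≤ m · uᵀ𝒟(M)u` for all `u`, and the column space of `M` is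
contained in the column space of `𝒟(M)`. -/
theorem stmt_10 (n m : ℕ) (M : Matrix (Fin n) (Fin n) ℝ) (hM : M.PosSemidef)
    (π : Fin n → Fin m)
    (D : Matrix (Fin n) (Fin n) ℝ)
    (hD : ∀ i j, D i j = if π i = π j then M i j else 0) :
    (∀ u : Fin n → ℝ, u ⬝ᵥ M *ᵥ u ≤ (m : ℝ) * (u ⬝ᵥ D *ᵥ u)) ∧
      LinearMap.range (Matrix.toLin' M) ≤ LinearMap.range (Matrix.toLin' D) := by
  have key := block_ineq n m M hM π D hD
  refine ⟨key, ?_⟩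
  have hMt : Mᵀ = M := by simpa using hM.isHermitian.eq
  have hDt : Dᵀ = D := by
    ext i j
    rw [transpose_apply, hD, hD]
    have : M j i = M i j := congrFun (congrFun hMt i) j
    simp [this, eq_comm]
  have hker : LinearMap.ker (toLin' D) ≤ LinearMap.ker (toLin' M) := by
    intro u hu
    rw [LinearMap.mem_ker, toLin'_apply] at hu ⊢
    have h0 := key u
    rw [hu, dotProduct_zero, mul_zero] at h0
    have h1 : 0 ≤ star u ⬝ᵥ M *ᵥ u := hM.dotProduct_mulVec_nonneg u
    exact (hM.dotProduct_mulVec_zero_iff u).1 (le_antisymm (by simpa using h0) h1)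
  obtain ⟨C, hC⟩ : ∃ C : (Fin n → ℝ) →ₗ[ℝ] (Fin n → ℝ), C ∘ₗ toLin' D = toLin' M := by
    obtain ⟨C, hC⟩ := LinearMap.exists_extend
      (((LinearMap.ker (toLin' D)).liftQ (toLin' M) hker) ∘ₗ
        (toLin' D).quotKerEquivRange.symm.toLinearMap)
    refine ⟨C, LinearMap.ext fun x => ?_⟩
    have h := LinearMap.congr_fun hC ⟨toLin' D x, LinearMap.mem_range_self _ x⟩
    have h2 : (toLin' D).quotKerEquivRange.symm ⟨toLin' D x, LinearMap.mem_range_self _ x⟩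
        = (LinearMap.ker (toLin' D)).mkQ x :=
      LinearMap.quotKerEquivRange_symm_apply_image _ x _
    rw [LinearMap.comp_apply, LinearMap.comp_apply, LinearEquiv.coe_coe, h2] at h
    rw [Submodule.mkQ_apply, Submodule.liftQ_apply] at h
    exact h
  have hCM : LinearMap.toMatrix' C * D = M := by
    apply toLin'.injective
    rw [toLin'_mul, toLin'_toMatrix', hC]
  have : M = D * (LinearMap.toMatrix' C)ᵀ := by
    rw [← hMt, ← hCM, transpose_mul, hDt]
  rw [this, toLin'_mul]
  exact LinearMap.range_comp_le_range _ _
end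

section
/- Let Ω be a finite nonempty set, φ : Ω → ℝ^K, and define the log partition function T(θ) = log Σ_{ω∈Ω} exp⟨θ, φ(ω)⟩ and its convex conjugate T* : ℝ^K → ℝ ∪ {+∞}, T*(μ) = sup_{θ∈ℝ^K} (⟨θ, μ⟩ − T(θ)). Let N ≥ 1, let a_1,…,a_N > 0 and θ̃_1,…,θ̃_N ∈ ℝ^K, and set θ̄ = (Σ_i θ̃_i/a_i)/(Σ_i 1/a_i) and μ̄ = Σ_{ω∈Ω} [exp⟨θ̄, φ(ω)⟩ / Σ_{ω'} exp⟨θ̄, φ(ω')⟩] · φ(ω) (the expectation of φ under the exponential-family distribution with natural parameter θ̄). Then T*(μ̄) < +∞, and μ̄ is the unique minimizer over {μ ∈ ℝ^K : T*(μ) < +∞} of the dual objective G(μ) = Σ_{i=1}^N (1/a_i)(T*(μ) − ⟨θ̃_i, μ⟩); i.e., G(μ̄) ≤ G(μ) for every μ with T*(μ) < +∞, with equality only if μ = μ̄. -/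
open Matrix

/-- Gradient inequality for the log partition function. -/
lemma logpart_grad_ineq {Ω : Type} [Fintype Ω] [Nonempty Ω] (x y : Ω → ℝ) :
    Real.log (∑ ω, Real.exp (x ω)) +
      ∑ ω, (Real.exp (x ω) / ∑ ω', Real.exp (x ω')) * (y ω - x ω)
      ≤ Real.log (∑ ω, Real.exp (y ω)) := by
  have hZ : 0 < ∑ ω, Real.exp (x ω) :=
    Finset.sum_pos (fun _ _ => Real.exp_pos _) Finset.univ_nonempty
  have hW : 0 < ∑ ω, Real.exp (y ω) :=
    Finset.sum_pos (fun _ _ => Real.exp_pos _) Finset.univ_nonempty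
  have hJ := convexOn_exp.map_sum_le (t := Finset.univ)
    (w := fun ω => Real.exp (x ω) / ∑ ω', Real.exp (x ω')) (p := fun ω => y ω - x ω)
    (fun _ _ => by positivity) (by rw [← Finset.sum_div]; exact div_self hZ.ne')
    (fun _ _ => Set.mem_univ _)
  simp only [smul_eq_mul] at hJ
  have h2 : ∑ ω, (Real.exp (x ω) / ∑ ω', Real.exp (x ω')) * Real.exp (y ω - x ω)
      = (∑ ω, Real.exp (y ω)) / ∑ ω', Real.exp (x ω') := by
    rw [Finset.sum_div]
    refine Finset.sum_congr rfl fun ω _ => ?_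
    rw [div_mul_eq_mul_div, ← Real.exp_add]
    congr 2
    ring
  rw [h2] at hJ
  have h3 := (Real.le_log_iff_exp_le (div_pos hW hZ)).2 hJ
  rw [Real.log_div hW.ne' hZ.ne'] at h3
  linarith

/-- Directional derivative of the log partition function. -/
lemma logpart_hasDerivAt {Ω : Type} [Fintype Ω] [Nonempty Ω] (x d : Ω → ℝ) :
    HasDerivAt (fun t : ℝ => Real.log (∑ ω, Real.exp (x ω + t * d ω)))
      (∑ ω, (Real.exp (x ω) / ∑ ω', Real.exp (x ω')) * d ω) 0 := by
  have hZ : 0 < ∑ ω, Real.exp (x ω) :=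
    Finset.sum_pos (fun _ _ => Real.exp_pos _) Finset.univ_nonempty
  have h1 : HasDerivAt (fun t : ℝ => ∑ ω, Real.exp (x ω + t * d ω))
      (∑ ω, Real.exp (x ω + 0 * d ω) * (1 * d ω)) 0 := by
    refine HasDerivAt.fun_sum fun ω _ => ?_
    exact (((hasDerivAt_id (0 : ℝ)).mul_const (d ω)).const_add (x ω)).exp
  have h2 := h1.log (by simpa using hZ.ne')
  convert h2 using 1
  rw [Finset.sum_div]
  refine Finset.sum_congr rfl fun ω _ => ?_
  simp only [zero_mul, add_zero, one_mul]
  ring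

/-- Market-clearing equilibrium prices in the exponential trader model.
With `T` the log partition function of the exponential family with sufficient statistic
`φ` over a finite outcome set `Ω`, `θ̄` the risk-aversion-weighted average of trader
beliefs, and `μ̄` the mean parameter at `θ̄`, the conjugate `T*` is finite at `μ̄`
(the defining supremum is bounded above), and `μ̄` is the unique minimizer of
`G(μ) = Σᵢ (1/aᵢ)(T*(μ) − ⟨θ̃ᵢ, μ⟩)` over the set where `T*` is finite. -/
theorem stmt_14 (K : ℕ) (Ω : Type) [Fintype Ω] [Nonempty Ω] (φ : Ω → Fin K → ℝ)
    (N : ℕ) (hN : 1 ≤ N) (a : Fin N → ℝ) (ha : ∀ i, 0 < a i)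
    (θt : Fin N → Fin K → ℝ)
    (T : (Fin K → ℝ) → ℝ)
    (hT : T = fun θ => Real.log (∑ ω, Real.exp (θ ⬝ᵥ φ ω)))
    (Tstar : (Fin K → ℝ) → ℝ)
    (hTstar : Tstar = fun μ => ⨆ θ : Fin K → ℝ, (θ ⬝ᵥ μ - T θ))
    (θbar : Fin K → ℝ)
    (hθbar : θbar = (∑ i, 1 / a i)⁻¹ • ∑ i, (1 / a i) • θt i)
    (μbar : Fin K → ℝ)
    (hμbar : μbar =
      ∑ ω, (Real.exp (θbar ⬝ᵥ φ ω) / ∑ ω', Real.exp (θbar ⬝ᵥ φ ω')) • φ ω)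
    (G : (Fin K → ℝ) → ℝ)
    (hG : G = fun μ => ∑ i, (1 / a i) * (Tstar μ - θt i ⬝ᵥ μ)) :
    BddAbove (Set.range fun θ : Fin K → ℝ => θ ⬝ᵥ μbar - T θ) ∧
      ∀ μ : Fin K → ℝ, BddAbove (Set.range fun θ : Fin K → ℝ => θ ⬝ᵥ μ - T θ) →
        G μbar ≤ G μ ∧ (G μbar = G μ → μ = μbar) := by
  have hmean : ∀ v : Fin K → ℝ, v ⬝ᵥ μbar =
      ∑ ω, (Real.exp (θbar ⬝ᵥ φ ω) / ∑ ω', Real.exp (θbar ⬝ᵥ φ ω')) * (v ⬝ᵥ φ ω) := by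
    intro v
    rw [hμbar, dotProduct_sum]
    simp only [dotProduct_smul, smul_eq_mul]
  have hgrad : ∀ θ : Fin K → ℝ, θ ⬝ᵥ μbar - T θ ≤ θbar ⬝ᵥ μbar - T θbar := by
    intro θ
    have h := logpart_grad_ineq (fun ω => θbar ⬝ᵥ φ ω) (fun ω => θ ⬝ᵥ φ ω)
    simp only [← sub_dotProduct] at h
    rw [← hmean, sub_dotProduct] at h
    simp only [hT]
    linarith
  have hbdd : BddAbove (Set.range fun θ : Fin K → ℝ => θ ⬝ᵥ μbar - T θ) :=
    ⟨θbar ⬝ᵥ μbar - T θbar, by rintro _ ⟨θ, rfl⟩; exact hgrad θ⟩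
  have hTb : Tstar μbar = θbar ⬝ᵥ μbar - T θbar := by
    rw [hTstar]
    exact le_antisymm (ciSup_le hgrad) (le_ciSup hbdd θbar)
  have hS : 0 < ∑ i, 1 / a i :=
    Finset.sum_pos (fun i _ => one_div_pos.2 (ha i)) ⟨⟨0, hN⟩, Finset.mem_univ _⟩
  have hGf : ∀ μ, G μ = (∑ i, 1 / a i) * (Tstar μ - θbar ⬝ᵥ μ) := by
    intro μ
    have h1 : (∑ i, 1 / a i) * (θbar ⬝ᵥ μ) = ∑ i, (1 / a i) * (θt i ⬝ᵥ μ) := by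
      rw [hθbar, smul_dotProduct, smul_eq_mul, mul_inv_cancel_left₀ hS.ne', sum_dotProduct]
      simp only [smul_dotProduct, smul_eq_mul]
    rw [mul_sub, h1, hG]
    simp only [mul_sub, Finset.sum_sub_distrib, Finset.sum_mul]
  refine ⟨hbdd, fun μ hμ => ?_⟩
  have hle : ∀ θ : Fin K → ℝ, θ ⬝ᵥ μ - T θ ≤ Tstar μ := by
    intro θ
    rw [hTstar]
    exact le_ciSup hμ θ
  rw [hGf, hGf, hTb]
  refine ⟨mul_le_mul_of_nonneg_left (by linarith [hle θbar]) hS.le, fun heq => ?_⟩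
  have heq' := mul_left_cancel₀ hS.ne' heq
  have hd := logpart_hasDerivAt (fun ω => θbar ⬝ᵥ φ ω) (fun ω => (μ - μbar) ⬝ᵥ φ ω)
  rw [← hmean] at hd
  have hd2 := hd.sub ((hasDerivAt_id (0 : ℝ)).mul_const ((μ - μbar) ⬝ᵥ μ))
  have hmin := IsLocalMin.hasDerivAt_eq_zero (Filter.Eventually.of_forall fun t => ?_) hd2
  · rw [one_mul, ← dotProduct_sub, ← neg_sub μ μbar, dotProduct_neg, neg_eq_zero,
      dotProduct_self_eq_zero] at hmin
    exact sub_eq_zero.1 hmin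
  · have h := hle (θbar + t • (μ - μbar))
    simp only [hT, add_dotProduct, smul_dotProduct, smul_eq_mul] at h heq'
    simp only [Pi.sub_apply, id, zero_mul, add_zero, sub_zero]
    linarith
end

section
/- Let F : ℝ^n → ℝ be convex and differentiable, let λ ∈ ℝ, and let S = {x ∈ ℝ^n : F(x) ≤ λ}. Let A and B be real symmetric positive-semidefinite n×n matrices such that (1/2)δᵀAδ ≤ F(y+δ) − F(y) − ⟨∇F(y), δ⟩ ≤ (1/2)δᵀBδ whenever y ∈ S and y+δ ∈ S. Let α ⊆ {1,…,n} be a set of coordinates, let V = {δ ∈ ℝ^n : δ_j = 0 for all j ∉ α}, let A_{αα} and B_{αα} be the principal submatrices of A and B on the rows and columns in α, and let X_A and X_B be their Moore–Penrose pseudoinverses. Let x ∈ S with F(x) < λ, and let g ∈ ℝ^{α} be the restriction of ∇F(x) to the coordinates in α; assume g lies in the column space of A_{αα} and in the column space of B_{αα}. Then F(x) − (1/2) gᵀ X_A g ≤ inf_{x' ∈ x + V} F(x') ≤ F(x) − (1/2) gᵀ X_B g. -/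
open Matrix

/-- Embedding of block vectors. -/
noncomputable def blockEmb {n : ℕ} (α : Finset (Fin n)) (u : {j // j ∈ α} → ℝ) : Fin n → ℝ :=
  ∑ j : {j // j ∈ α}, u j • Pi.single (j : Fin n) (1 : ℝ)

lemma blockEmb_apply_mem {n : ℕ} (α : Finset (Fin n)) (u : {j // j ∈ α} → ℝ)
    (i : {j // j ∈ α}) : blockEmb α u i = u i := by
  unfold blockEmb
  rw [Finset.sum_apply, Finset.sum_eq_single i]
  · simp
  · intro b _ hb
    have : (i : Fin n) ≠ b := fun h => hb (Subtype.ext h.symm)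
    simp [Pi.single_apply, this]
  · simp

lemma blockEmb_apply_not {n : ℕ} (α : Finset (Fin n)) (u : {j // j ∈ α} → ℝ)
    (i : Fin n) (hi : i ∉ α) : blockEmb α u i = 0 := by
  unfold blockEmb
  rw [Finset.sum_apply]
  apply Finset.sum_eq_zero
  intro b _
  have : i ≠ b := fun h => hi (h ▸ b.2)
  simp [Pi.single_apply, this]

lemma blockEmb_quad {n : ℕ} (α : Finset (Fin n)) (u : {j // j ∈ α} → ℝ)
    (A : Matrix (Fin n) (Fin n) ℝ) :
    blockEmb α u ⬝ᵥ A *ᵥ blockEmb α u = u ⬝ᵥ (A.submatrix (fun i : {j // j ∈ α} => (i : Fin n))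
      (fun i : {j // j ∈ α} => (i : Fin n))) *ᵥ u := by
  have h1 : ∀ v : Fin n → ℝ, blockEmb α u ⬝ᵥ v = ∑ j : {j // j ∈ α}, u j * v j := by
    intro v
    unfold blockEmb
    rw [sum_dotProduct]
    simp
  rw [h1]
  simp only [dotProduct]
  refine Finset.sum_congr rfl fun j _ => ?_
  congr 1
  have : (A *ᵥ blockEmb α u) j = blockEmb α u ⬝ᵥ A j := by
    rw [dotProduct_comm]; rfl
  rw [this, h1]
  simp [mulVec, dotProduct, mul_comm]

lemma pinv_quad {m : Type*} [Fintype m] (M X : Matrix m m ℝ) (hM : M.PosSemidef)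
    (h : M * X * M = M) (w : m → ℝ) : (M *ᵥ w) ⬝ᵥ X *ᵥ (M *ᵥ w) = w ⬝ᵥ M *ᵥ w := by
  have hs : Mᵀ = M := by simpa using hM.isHermitian.eq
  have : (M *ᵥ w) = w ᵥ* M := by rw [← vecMul_transpose, hs]
  have h2 : ∀ v, (M *ᵥ w) ⬝ᵥ v = w ⬝ᵥ M *ᵥ v := by
    intro v
    rw [this, ← dotProduct_mulVec]
  rw [h2, mulVec_mulVec, mulVec_mulVec, h]

lemma psd_expand {m : Type*} [Fintype m] (M : Matrix m m ℝ) (hM : M.PosSemidef)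
    (u w : m → ℝ) : 0 ≤ u ⬝ᵥ M *ᵥ u + 2 * ((M *ᵥ w) ⬝ᵥ u) + w ⬝ᵥ M *ᵥ w := by
  have hs : Mᵀ = M := by simpa using hM.isHermitian.eq
  have h := hM.dotProduct_mulVec_nonneg (u + w)
  have h2 : w ⬝ᵥ M *ᵥ u = (M *ᵥ w) ⬝ᵥ u := by
    rw [dotProduct_mulVec, ← mulVec_transpose, hs]
  have h3 : u ⬝ᵥ M *ᵥ w = (M *ᵥ w) ⬝ᵥ u := dotProduct_comm _ _
  simp only [star_trivial, mulVec_add, add_dotProduct, dotProduct_add] at h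
  linarith

/-- One-step progress bound for exact block-coordinate minimization.
If `F` is convex and differentiable, strongly convex w.r.t. `A` and smooth w.r.t. `B`
on the sublevel set `S = {F ≤ λ}`, `x ∈ S` with `F x < λ`, and the restriction `g` of
the gradient of `F` at `x` to the block `α` lies in the column spaces of the principal
submatrices `A_{αα}` and `B_{αα}` (with pseudoinverses `XA`, `XB`), then
`F x − (1/2) gᵀ XA g ≤ inf {F x' : x' agrees with x off α} ≤ F x − (1/2) gᵀ XB g`. -/
theorem stmt_18 (n : ℕ) (F : (Fin n → ℝ) → ℝ)
    (hFconv : ConvexOn ℝ Set.univ F) (hFdiff : Differentiable ℝ F)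
    (lam : ℝ) (S : Set (Fin n → ℝ)) (hSdef : S = {y | F y ≤ lam})
    (A B : Matrix (Fin n) (Fin n) ℝ) (hA : A.PosSemidef) (hB : B.PosSemidef)
    (hquad : ∀ y ∈ S, ∀ δ : Fin n → ℝ, y + δ ∈ S →
      (1 / 2) * (δ ⬝ᵥ A *ᵥ δ) ≤ F (y + δ) - F y - fderiv ℝ F y δ ∧
        F (y + δ) - F y - fderiv ℝ F y δ ≤ (1 / 2) * (δ ⬝ᵥ B *ᵥ δ))
    (α : Finset (Fin n))
    (Asub Bsub XA XB : Matrix {j // j ∈ α} {j // j ∈ α} ℝ)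
    (hAsub : Asub = A.submatrix (fun i : {j // j ∈ α} => (i : Fin n))
      (fun i : {j // j ∈ α} => (i : Fin n)))
    (hBsub : Bsub = B.submatrix (fun i : {j // j ∈ α} => (i : Fin n))
      (fun i : {j // j ∈ α} => (i : Fin n)))
    (hXA1 : Asub * XA * Asub = Asub) (hXA2 : XA * Asub * XA = XA)
    (hXA3 : (Asub * XA)ᵀ = Asub * XA) (hXA4 : (XA * Asub)ᵀ = XA * Asub)
    (hXB1 : Bsub * XB * Bsub = Bsub) (hXB2 : XB * Bsub * XB = XB)
    (hXB3 : (Bsub * XB)ᵀ = Bsub * XB) (hXB4 : (XB * Bsub)ᵀ = XB * Bsub)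
    (x : Fin n → ℝ) (hxS : x ∈ S) (hxlt : F x < lam)
    (g : {j // j ∈ α} → ℝ)
    (hg : ∀ j : {j // j ∈ α}, g j = fderiv ℝ F x (Pi.single (j : Fin n) 1))
    (hgA : ∃ w, Asub *ᵥ w = g) (hgB : ∃ w, Bsub *ᵥ w = g) :
    F x - (1 / 2) * (g ⬝ᵥ XA *ᵥ g) ≤
        sInf (F '' {x' | ∀ j : Fin n, j ∉ α → x' j = x j}) ∧
      sInf (F '' {x' | ∀ j : Fin n, j ∉ α → x' j = x j}) ≤
        F x - (1 / 2) * (g ⬝ᵥ XB *ᵥ g) := by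
  subst hSdef
  have hAp : Asub.PosSemidef := hAsub ▸ hA.submatrix _
  have hBp : Bsub.PosSemidef := hBsub ▸ hB.submatrix _
  have hlin : ∀ u, fderiv ℝ F x (blockEmb α u) = g ⬝ᵥ u := by
    intro u
    unfold blockEmb
    rw [map_sum]
    simp only [map_smul, dotProduct, hg, smul_eq_mul, mul_comm]
  obtain ⟨wA, hwA⟩ := hgA
  obtain ⟨wB, hwB⟩ := hgB
  have hcA : g ⬝ᵥ XA *ᵥ g = wA ⬝ᵥ Asub *ᵥ wA := by
    rw [← hwA]; exact pinv_quad _ _ hAp hXA1 _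
  have hcB : g ⬝ᵥ XB *ᵥ g = wB ⬝ᵥ Bsub *ᵥ wB := by
    rw [← hwB]; exact pinv_quad _ _ hBp hXB1 _
  have hA0 : 0 ≤ wA ⬝ᵥ Asub *ᵥ wA := by simpa using hAp.dotProduct_mulVec_nonneg wA
  have hB0 : 0 ≤ wB ⬝ᵥ Bsub *ᵥ wB := by simpa using hBp.dotProduct_mulVec_nonneg wB
  have hgw : g ⬝ᵥ wB = wB ⬝ᵥ Bsub *ᵥ wB := by rw [hwB, dotProduct_comm]
  rw [hcA, hcB]
  have hlow : ∀ z ∈ F '' {x' | ∀ j : Fin n, j ∉ α → x' j = x j},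
      F x - (1 / 2) * (wA ⬝ᵥ Asub *ᵥ wA) ≤ z := by
    rintro _ ⟨x', hx', rfl⟩
    by_cases hS : F x' ≤ lam
    · have hxe : x + blockEmb α (fun j => x' j - x j) = x' := by
        funext i
        by_cases hi : i ∈ α
        · have := blockEmb_apply_mem α (fun j => x' j - x j) ⟨i, hi⟩
          simp only at this
          simp [this]
        · simp [blockEmb_apply_not α _ i hi, hx' i hi]
      have h := (hquad x hxS (blockEmb α (fun j => x' j - x j)) (by rw [hxe]; exact hS)).1
      rw [hxe, hlin, blockEmb_quad, ← hAsub] at h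
      have h2 := psd_expand Asub hAp (fun j => x' j - x j) wA
      rw [hwA] at h2
      rw [hwA] at *
      linarith
    · push Not at hS
      linarith
  refine ⟨le_csInf ⟨F x, x, fun _ _ => rfl, rfl⟩ hlow, ?_⟩
  have hup : ∀ t : ℝ, F (x + blockEmb α ((-t) • wB)) ≤ lam →
      F (x + blockEmb α ((-t) • wB)) ≤ F x - t * (wB ⬝ᵥ Bsub *ᵥ wB)
        + t ^ 2 / 2 * (wB ⬝ᵥ Bsub *ᵥ wB) := by
    intro t ht
    have h := (hquad x hxS _ ht).2
    rw [hlin, blockEmb_quad, ← hBsub, mulVec_smul, smul_dotProduct, dotProduct_smul,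
      dotProduct_smul, hgw] at h
    simp only [smul_eq_mul] at h
    linarith
  have hcont : Continuous fun t : ℝ => F (x + blockEmb α ((-t) • wB)) := by
    refine hFdiff.continuous.comp ?_
    unfold blockEmb
    simp only [Pi.smul_apply]
    fun_prop
  have h1 : F (x + blockEmb α ((-1 : ℝ) • wB)) ≤ lam := by
    by_contra hc
    push Not at hc
    have hz : F (x + blockEmb α ((-0 : ℝ) • wB)) = F x := by
      congr 1; simp [blockEmb]
    obtain ⟨t, ⟨ht0, ht1⟩, ht⟩ := intermediate_value_Icc (zero_le_one (α := ℝ))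
      hcont.continuousOn (show lam ∈ Set.Icc _ _ from ⟨by simp only [hz]; exact hxlt.le, hc.le⟩)
    simp only at ht
    have := hup t ht.le
    rw [ht] at this
    have : 0 ≤ t * (1 - t / 2) * (wB ⬝ᵥ Bsub *ᵥ wB) :=
      mul_nonneg (mul_nonneg ht0 (by linarith)) hB0
    nlinarith
  have h2 := hup 1 h1
  refine (csInf_le ⟨_, hlow⟩ ⟨_, ?_, rfl⟩).trans (h2.trans (by linarith))
  intro j hj
  simp [blockEmb_apply_not α _ j hj]
end

section
/- Let Ω be a finite nonempty set, φ : Ω → ℝ^K, and T(θ) = log Σ_{ω∈Ω} exp⟨θ, φ(ω)⟩, and suppose the gradient ∇T is Lipschitz with constant L_T > 0. Let C : ℝ^K → ℝ be convex and differentiable with ∇C Lipschitz with constant L_C > 0, let b > 0, N ≥ 1, a_1,…,a_N > 0, and θ̃_1,…,θ̃_N ∈ ℝ^K. Define the potential F : (ℝ^K)^N → ℝ by F(r) = Σ_{i=1}^N (1/a_i) T(θ̃_i − a_i r_i) + b·C((Σ_{i=1}^N r_i)/b). Suppose r* minimizes F, let F* = F(r*), and set μ* = ∇C((Σ_i r*_i)/b).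 Then for every r ∈ (ℝ^K)^N, F(r) − F* ≥ (b/(2L_C))·‖∇C((Σ_i r_i)/b) − μ*‖² + Σ_{i=1}^N (1/(2 a_i L_T))·‖∇T(θ̃_i − a_i r_i) − μ*‖². -/
open RealInnerProductSpace

theorem aux_descent {E : Type*} [NormedAddCommGroup E] [InnerProductSpace ℝ E] [CompleteSpace E]
    (f : E → ℝ) (hf : Differentiable ℝ f) (L : ℝ)
    (hl : ∀ x y, ‖gradient f x - gradient f y‖ ≤ L * ‖x - y‖) (x v : E) :
    f (x + v) ≤ f x + ⟪gradient f x, v⟫ + L / 2 * ‖v‖ ^ 2 := by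
  have hd : ∀ t : ℝ, HasDerivAt
      (fun t : ℝ => f (x + t • v) - t * ⟪gradient f x, v⟫ - L / 2 * ‖v‖ ^ 2 * t ^ 2)
      (⟪gradient f (x + t • v), v⟫ - ⟪gradient f x, v⟫ - L * ‖v‖ ^ 2 * t) t := by
    intro t
    have h1 : HasDerivAt (fun t : ℝ => x + t • v) v t := by
      simpa using ((hasDerivAt_id t).smul_const v).const_add x
    have h2 := ((hf (x + t • v)).hasGradientAt.hasFDerivAt).comp_hasDerivAt t h1
    have h3 : HasDerivAt (fun t : ℝ => f (x + t • v)) ⟪gradient f (x + t • v), v⟫ t := by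
      simpa [Function.comp_def] using h2
    have h4 : HasDerivAt (fun t : ℝ => t * ⟪gradient f x, v⟫) ⟪gradient f x, v⟫ t := by
      simpa using (hasDerivAt_id t).mul_const ⟪gradient f x, v⟫
    have h5 := (hasDerivAt_pow 2 t).const_mul (L / 2 * ‖v‖ ^ 2)
    refine ((h3.sub h4).sub h5).congr_deriv ?_
    push_cast
    ring
  have hanti : AntitoneOn
      (fun t : ℝ => f (x + t • v) - t * ⟪gradient f x, v⟫ - L / 2 * ‖v‖ ^ 2 * t ^ 2)
      (Set.Ici 0) := by
    apply antitoneOn_of_deriv_nonpos (convex_Ici 0)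
    · exact fun t _ => (hd t).continuousAt.continuousWithinAt
    · exact fun t _ => (hd t).differentiableAt.differentiableWithinAt
    · intro t ht
      rw [interior_Ici] at ht
      have ht' : 0 < t := ht
      rw [(hd t).deriv, ← inner_sub_left]
      have h1 := real_inner_le_norm (gradient f (x + t • v) - gradient f x) v
      have h2 := hl (x + t • v) x
      rw [add_sub_cancel_left, norm_smul, Real.norm_of_nonneg ht'.le] at h2
      have h3 := mul_le_mul_of_nonneg_right h2 (norm_nonneg v)
      nlinarith
  have := hanti (Set.mem_Ici.2 le_rfl) (Set.mem_Ici.2 zero_le_one) zero_le_one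
  simp only [one_smul, zero_smul, add_zero, one_mul, zero_mul, one_pow, mul_one, sub_zero,
    ne_eq, OfNat.ofNat_ne_zero, not_false_eq_true, zero_pow, mul_zero] at this
  linarith

theorem aux_convex {E : Type*} [NormedAddCommGroup E] [InnerProductSpace ℝ E] [CompleteSpace E]
    (f : E → ℝ) (hf : Differentiable ℝ f) (hc : ConvexOn ℝ Set.univ f) (x v : E) :
    f x + ⟪gradient f x, v⟫ ≤ f (x + v) := by
  have h1 : HasDerivAt (fun t : ℝ => x + t • v) v 0 := by
    simpa using ((hasDerivAt_id (0:ℝ)).smul_const v).const_add x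
  have h2 := ((hf (x + (0:ℝ) • v)).hasGradientAt.hasFDerivAt).comp_hasDerivAt 0 h1
  have h3 : HasDerivAt (fun t : ℝ => f (x + t • v)) ⟪gradient f x, v⟫ 0 := by
    simpa [Function.comp_def] using h2
  have hc' : ConvexOn ℝ Set.univ (fun t : ℝ => f (x + t • v)) := by
    refine ⟨convex_univ, fun s _ t _ p q hp hq hpq => ?_⟩
    have := hc.2 (Set.mem_univ (x + s • v)) (Set.mem_univ (x + t • v)) hp hq hpq
    convert this using 2
    have hq' : q = 1 - p := by linarith
    subst hq'
    simp only [smul_eq_mul]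
    module
  have := hc'.le_slope_of_hasDerivAt (Set.mem_univ 0) (Set.mem_univ 1) zero_lt_one h3
  simp only [slope_def_field, one_smul, zero_smul, add_zero, sub_zero, div_one] at this
  linarith

theorem aux_coco {E : Type*} [NormedAddCommGroup E] [InnerProductSpace ℝ E] [CompleteSpace E]
    (f : E → ℝ) (hf : Differentiable ℝ f) (L : ℝ) (hL : 0 < L)
    (hc : ∀ x v, f x + ⟪gradient f x, v⟫ ≤ f (x + v))
    (hl : ∀ x y, ‖gradient f x - gradient f y‖ ≤ L * ‖x - y‖) (x y : E) :
    f x + ⟪gradient f x, y - x⟫ + 1 / (2 * L) * ‖gradient f y - gradient f x‖ ^ 2 ≤ f y := by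
  set d := gradient f y - gradient f x with hd
  have h1 := aux_descent f hf L hl y (-(L⁻¹ • d))
  have h2 := hc x (y - x + -(L⁻¹ • d))
  have e : x + (y - x + -(L⁻¹ • d)) = y + -(L⁻¹ • d) := by abel
  rw [e, inner_add_right] at h2
  have h3 : ⟪gradient f y, -(L⁻¹ • d)⟫ - ⟪gradient f x, -(L⁻¹ • d)⟫ = - (L⁻¹ * ‖d‖ ^ 2) := by
    rw [← inner_sub_left, ← hd, inner_neg_right, inner_smul_right, real_inner_self_eq_norm_sq]
  have h4 : L / 2 * ‖-(L⁻¹ • d)‖ ^ 2 = 1 / (2 * L) * ‖d‖ ^ 2 := by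
    rw [norm_neg, norm_smul, Real.norm_of_nonneg (by positivity)]
    field_simp
  have h5 : L⁻¹ * ‖d‖ ^ 2 = 2 * (1 / (2 * L) * ‖d‖ ^ 2) := by field_simp
  linarith

theorem aux_lse {E : Type*} [NormedAddCommGroup E] [InnerProductSpace ℝ E] [CompleteSpace E]
    {Ω : Type} [Fintype Ω] [Nonempty Ω] (φ : Ω → E) (T : E → ℝ)
    (hT : T = fun θ => Real.log (∑ ω, Real.exp ⟪θ, φ ω⟫)) :
    Differentiable ℝ T ∧ ∀ x v, T x + ⟪gradient T x, v⟫ ≤ T (x + v) := by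
  have hpos : ∀ x : E, 0 < ∑ ω, Real.exp ⟪x, φ ω⟫ := fun x =>
    Finset.sum_pos (fun ω _ => Real.exp_pos _) Finset.univ_nonempty
  have hg : ∀ x, HasGradientAt T
      ((∑ ω, Real.exp ⟪x, φ ω⟫)⁻¹ • ∑ ω, Real.exp ⟪x, φ ω⟫ • φ ω) x := by
    intro x
    rw [hasGradientAt_iff_hasFDerivAt, hT]
    have h1 : ∀ ω ∈ Finset.univ, HasFDerivAt (fun θ : E => Real.exp ⟪θ, φ ω⟫)
        (Real.exp ⟪x, φ ω⟫ • innerSL ℝ (φ ω)) x := by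
      intro ω _
      have : HasFDerivAt (fun θ : E => ⟪θ, φ ω⟫) (innerSL ℝ (φ ω)) x := by
        have := (innerSL ℝ (φ ω)).hasFDerivAt (x := x)
        simpa [real_inner_comm] using this
      exact this.exp
    have h2 := (HasFDerivAt.fun_sum h1).log (hpos x).ne'
    refine h2.congr_fderiv ?_
    apply ContinuousLinearMap.ext
    intro v
    simp [inner_smul_left, sum_inner]
  refine ⟨fun x => (hg x).differentiableAt, fun x v => ?_⟩
  rw [(hg x).gradient]
  set S := ∑ ω, Real.exp ⟪x, φ ω⟫ with hS
  have hSp : 0 < S := hpos x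
  set m := ⟪S⁻¹ • ∑ ω, Real.exp ⟪x, φ ω⟫ • φ ω, v⟫ with hm
  have hm' : S * m = ∑ ω, Real.exp ⟪x, φ ω⟫ * ⟪v, φ ω⟫ := by
    rw [hm, inner_smul_left, sum_inner]
    simp only [inner_smul_left, real_inner_comm, RCLike.conj_to_real]
    field_simp
  have key : S * Real.exp m ≤ ∑ ω, Real.exp ⟪x + v, φ ω⟫ := by
    have : ∀ ω, Real.exp m * (Real.exp ⟪x, φ ω⟫ * (1 - m) + Real.exp ⟪x, φ ω⟫ * ⟪v, φ ω⟫)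
        ≤ Real.exp ⟪x + v, φ ω⟫ := by
      intro ω
      have h := Real.add_one_le_exp (⟪v, φ ω⟫ - m)
      have e : Real.exp ⟪x + v, φ ω⟫
          = Real.exp m * (Real.exp ⟪x, φ ω⟫ * Real.exp (⟪v, φ ω⟫ - m)) := by
        rw [← Real.exp_add, ← Real.exp_add, inner_add_left]
        congr 1
        ring
      rw [e, ← mul_add]
      gcongr
      linarith
    have h := Finset.sum_le_sum (fun ω (_ : ω ∈ Finset.univ) => this ω)
    rw [← Finset.mul_sum, Finset.sum_add_distrib, ← Finset.sum_mul, ← hS, ← hm'] at h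
    linarith
  have := Real.log_le_log (by positivity) key
  rw [Real.log_mul hSp.ne' (Real.exp_pos _).ne', Real.log_exp] at this
  simp only [hT]
  exact this

/-- Suboptimality of the market potential bounds the squared
convergence error of market and trader prices. Here `T` is the log partition function
of the exponential family with sufficient statistic `φ` over a finite outcome set `Ω`
(with `∇T` Lipschitz with constant `L_T`), `C` is a convex differentiable cost function
with `∇C` Lipschitz with constant `L_C`, `b > 0` is the liquidity,
`F(r) = Σᵢ (1/aᵢ) T(θ̃ᵢ − aᵢ rᵢ) + b·C((Σᵢ rᵢ)/b)` is the potential with minimizer `r*`,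
and `μ* = ∇C((Σᵢ r*ᵢ)/b)` is the market-maker equilibrium price. -/
theorem stmt_19 (K : ℕ) (Ω : Type) [Fintype Ω] [Nonempty Ω]
    (φ : Ω → EuclideanSpace ℝ (Fin K))
    (T : EuclideanSpace ℝ (Fin K) → ℝ)
    (hT : T = fun θ => Real.log (∑ ω, Real.exp ⟪θ, φ ω⟫))
    (LT : ℝ) (hLT : 0 < LT)
    (hTlip : ∀ x y : EuclideanSpace ℝ (Fin K),
      ‖gradient T x - gradient T y‖ ≤ LT * ‖x - y‖)
    (C : EuclideanSpace ℝ (Fin K) → ℝ)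
    (hCconv : ConvexOn ℝ Set.univ C) (hCdiff : Differentiable ℝ C)
    (LC : ℝ) (hLC : 0 < LC)
    (hClip : ∀ x y : EuclideanSpace ℝ (Fin K),
      ‖gradient C x - gradient C y‖ ≤ LC * ‖x - y‖)
    (b : ℝ) (hb : 0 < b) (N : ℕ) (hN : 1 ≤ N)
    (a : Fin N → ℝ) (ha : ∀ i, 0 < a i)
    (θt : Fin N → EuclideanSpace ℝ (Fin K))
    (F : (Fin N → EuclideanSpace ℝ (Fin K)) → ℝ)
    (hF : F = fun r => (∑ i, (1 / a i) * T (θt i - a i • r i)) +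
      b * C (b⁻¹ • ∑ i, r i))
    (rstar : Fin N → EuclideanSpace ℝ (Fin K))
    (hmin : ∀ r, F rstar ≤ F r)
    (μstar : EuclideanSpace ℝ (Fin K))
    (hμstar : μstar = gradient C (b⁻¹ • ∑ i, rstar i)) :
    ∀ r : Fin N → EuclideanSpace ℝ (Fin K),
      b / (2 * LC) * ‖gradient C (b⁻¹ • ∑ i, r i) - μstar‖ ^ 2 +
          ∑ i, 1 / (2 * a i * LT) * ‖gradient T (θt i - a i • r i) - μstar‖ ^ 2 ≤
        F r - F rstar := by
  obtain ⟨hTdiff, hTconv⟩ := aux_lse φ T hT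
  have hopt : ∀ i, gradient T (θt i - a i • rstar i) = μstar := by
    intro i
    set g := gradient T (θt i - a i • rstar i) with hg
    have hai := ha i
    set M := a i * LT + LC / b with hM
    have hMp : 0 < M := by positivity
    set v := -(M⁻¹ • (μstar - g)) with hv
    have h1 := hmin (Function.update rstar i (rstar i + v))
    have hs : ∑ j, Function.update rstar i (rstar i + v) j = (∑ j, rstar j) + v := by
      rw [← sub_eq_iff_eq_add', ← Finset.sum_sub_distrib, Finset.sum_eq_single i]
      · simp
      · intro j _ hj
        simp [Function.update_of_ne hj]
      · simp
    have hs2 : ∑ j, (1 / a j) * T (θt j - a j • Function.update rstar i (rstar i + v) j)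
        = (∑ j, (1 / a j) * T (θt j - a j • rstar j))
          + ((1 / a i) * T (θt i - a i • rstar i + -(a i • v))
            - (1 / a i) * T (θt i - a i • rstar i)) := by
      rw [← sub_eq_iff_eq_add', ← Finset.sum_sub_distrib, Finset.sum_eq_single i]
      · simp only [Function.update_self]
        congr 3
        module
      · intro j _ hj
        simp [Function.update_of_ne hj]
      · simp
    simp only [hF] at h1
    rw [hs, hs2, smul_add] at h1
    have h2 := aux_descent T hTdiff LT hTlip (θt i - a i • rstar i) (-(a i • v))
    have h3 := aux_descent C hCdiff LC hClip (b⁻¹ • ∑ j, rstar j) (b⁻¹ • v)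
    rw [← hμstar, inner_smul_right, norm_smul, Real.norm_of_nonneg (by positivity)] at h3
    rw [← hg, inner_neg_right, inner_smul_right, norm_neg, norm_smul,
      Real.norm_of_nonneg hai.le] at h2
    have h2' := mul_le_mul_of_nonneg_left h2 (by positivity : 0 ≤ 1 / a i)
    have h3' := mul_le_mul_of_nonneg_left h3 hb.le
    have e2 : 1 / a i * (T (θt i - a i • rstar i) + -(a i * ⟪g, v⟫) + LT / 2 * (a i * ‖v‖) ^ 2)
        = 1 / a i * T (θt i - a i • rstar i) - ⟪g, v⟫ + a i * LT / 2 * ‖v‖ ^ 2 := by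
      field_simp
      try ring
    have e3 : b * (C (b⁻¹ • ∑ j, rstar j) + b⁻¹ * ⟪μstar, v⟫ + LC / 2 * (b⁻¹ * ‖v‖) ^ 2)
        = b * C (b⁻¹ • ∑ j, rstar j) + ⟪μstar, v⟫ + LC / b / 2 * ‖v‖ ^ 2 := by
      field_simp
    rw [e2] at h2'
    rw [e3] at h3'
    have h4 : ⟪μstar, v⟫ - ⟪g, v⟫ = -(M⁻¹ * ‖μstar - g‖ ^ 2) := by
      rw [← inner_sub_left, hv, inner_neg_right, inner_smul_right, real_inner_self_eq_norm_sq]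
    have h5 : M / 2 * ‖v‖ ^ 2 = M⁻¹ * ‖μstar - g‖ ^ 2 / 2 := by
      rw [hv, norm_neg, norm_smul, Real.norm_of_nonneg (by positivity)]
      field_simp
    have h6 : M⁻¹ * ‖μstar - g‖ ^ 2 ≤ 0 := by
      have : M / 2 * ‖v‖ ^ 2 = a i * LT / 2 * ‖v‖ ^ 2 + LC / b / 2 * ‖v‖ ^ 2 := by
        rw [hM]; ring
      linarith
    have h7 : ‖μstar - g‖ ^ 2 ≤ 0 := by
      by_contra hcon
      push Not at hcon
      have := mul_pos (inv_pos.2 hMp) hcon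
      linarith
    have h8 : ‖μstar - g‖ = 0 := by
      have := norm_nonneg (μstar - g)
      nlinarith
    exact (sub_eq_zero.1 (norm_eq_zero.1 h8)).symm
  intro r
  have hA : ∀ i, 1 / (2 * a i * LT) * ‖gradient T (θt i - a i • r i) - μstar‖ ^ 2
      ≤ (1 / a i) * T (θt i - a i • r i) - (1 / a i) * T (θt i - a i • rstar i)
        + ⟪μstar, r i - rstar i⟫ := by
    intro i
    have hai := ha i
    have h := aux_coco T hTdiff LT hLT hTconv hTlip (θt i - a i • rstar i) (θt i - a i • r i)
    have e : (θt i - a i • r i) - (θt i - a i • rstar i) = -(a i • (r i - rstar i)) := by module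
    rw [hopt i, e, inner_neg_right, inner_smul_right] at h
    have h' := mul_le_mul_of_nonneg_left h (by positivity : 0 ≤ 1 / a i)
    have e1 : 1 / (2 * a i * LT) * ‖gradient T (θt i - a i • r i) - μstar‖ ^ 2 =
      1 / a i * (1 / (2 * LT) * ‖gradient T (θt i - a i • r i) - μstar‖ ^ 2) := by
      field_simp
    have e2 : 1 / a i * (a i * ⟪μstar, r i - rstar i⟫) = ⟪μstar, r i - rstar i⟫ := by
      field_simp
    rw [mul_add, mul_add, mul_neg, e2, ← e1] at h'
    linarith
  have hB := aux_coco C hCdiff LC hLC (aux_convex C hCdiff hCconv) hClip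
    (b⁻¹ • ∑ i, rstar i) (b⁻¹ • ∑ i, r i)
  rw [← hμstar, ← smul_sub, ← Finset.sum_sub_distrib, inner_smul_right, inner_sum] at hB
  have hB' := mul_le_mul_of_nonneg_left hB hb.le
  have e1 : b * (b⁻¹ * ∑ i, ⟪μstar, r i - rstar i⟫) = ∑ i, ⟪μstar, r i - rstar i⟫ := by
    field_simp
  have e2 : b * (1 / (2 * LC) * ‖gradient C (b⁻¹ • ∑ i, r i) - μstar‖ ^ 2)
      = b / (2 * LC) * ‖gradient C (b⁻¹ • ∑ i, r i) - μstar‖ ^ 2 := by ring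
  rw [mul_add, mul_add, e1, e2] at hB'
  have hS := Finset.sum_le_sum (fun i (_ : i ∈ Finset.univ) => hA i)
  rw [Finset.sum_add_distrib, Finset.sum_sub_distrib] at hS
  simp only [hF]
  linarith
end
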